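/- Let v ≥ 2 and let L = {1^a, x^b, y^c} be a multiset of size v − 1 with a, b, c ≥ 1, 1 < x < y ≤ ⌊v/2⌋ and gcd(v,x) = gcd(v,y) = 1. With ẋ, ẏ, ẍ, ÿ and f as defined from L: if a ≥ f(x,y), or b ≥ f(ẋ,ẏ), or c ≥ f(ẍ,ÿ), then L is realizable. Consequently, if L is not realizable then f(x,y) + f(ẋ,ẏ) + f(ẍ,ÿ) ≥ v + 2. -/

import Mathlib

/-- The multiset of absolute differences of consecutive entries of a list of naturals. -/
def linDiffs (l : List ℕ) : Multiset ℕ :=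
  ↑(List.zipWith (fun a b => (a - b) + (b - a)) l l.tail)

/-- `l` is a linear realization of the multiset `L`: it lists `0, …, |L|`
(each exactly once) and its consecutive absolute differences form `L`. -/
def IsLinearRealization (L : Multiset ℕ) (l : List ℕ) : Prop :=
  l.Perm (List.range (Multiset.card L + 1)) ∧ linDiffs l = L

def HasLinearRealization (L : Multiset ℕ) : Prop :=
  ∃ l : List ℕ, IsLinearRealization L l

/-- A standard linear realization starts at `0`. -/
def HasStandardLinearRealization (L : Multiset ℕ) : Prop :=
  ∃ l : List ℕ, IsLinearRealization L l ∧ l.head? = some 0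

/-- A perfect linear realization starts at `0` and ends at `v - 1 = |L|`. -/
def HasPerfectLinearRealization (L : Multiset ℕ) : Prop :=
  ∃ l : List ℕ, IsLinearRealization L l ∧ l.head? = some 0 ∧
    l.getLast? = some (Multiset.card L)

/-- The multiset of cyclic edge-lengths `min(|gᵢ₊₁ - gᵢ|, v - |gᵢ₊₁ - gᵢ|)`
of consecutive entries of a list of naturals. -/
def cycDiffs (v : ℕ) (l : List ℕ) : Multiset ℕ :=
  ↑(List.zipWith (fun a b => min ((a - b) + (b - a)) (v - ((a - b) + (b - a)))) l l.tail)

/-- `L` is (cyclically) realizable in `K_v`: some Hamiltonian path on the vertex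
set `{0, …, v-1}` has `L` as its multiset of edge-lengths. -/
def IsRealizable (v : ℕ) (L : Multiset ℕ) : Prop :=
  ∃ l : List ℕ, l.Perm (List.range v) ∧ cycDiffs v l = L

/-- The multiset `{1^a, x^b, y^c}`. -/
def mset3 (a b c x y : ℕ) : Multiset ℕ :=
  Multiset.replicate a 1 + Multiset.replicate b x + Multiset.replicate c y

/-- With `b = q'x + r'`, `0 ≤ r' < x`: `ω(x,b) = x - 1` if `q' = 0`, `r' = 1`,
or at least one of `x`, `r'` is even; otherwise `ω(x,b) = x`. -/
def omegaBHR (x b : ℕ) : ℕ :=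
  if b / x = 0 ∨ b % x = 1 ∨ Even x ∨ Even (b % x) then x - 1 else x

/-- The reduced form `ĝ = min(g, v - g)`. -/
def reducedForm (v g : ℕ) : ℕ := min g (v - g)

/-- The function `f` of Theorem 3.7 (counterexample characterization refined). -/
def fBHR (u w : ℕ) : ℕ :=
  if Even u ∧ Even w then w - 1
  else if u = 3 ∨ (Even u ∧ ¬ Even w) then u + w - 2
  else u + w - 1

/-- A multiset `L` of size `v - 1` with elements in `{1, …, ⌊v/2⌋}` is admissible
if for every divisor `d` of `v` the number of elements of `L` divisible by `d`
is at most `v - d`. -/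
def IsAdmissible (v : ℕ) (L : Multiset ℕ) : Prop :=
  Multiset.card L = v - 1 ∧ (∀ z ∈ L, 1 ≤ z ∧ z ≤ v / 2) ∧
  ∀ d : ℕ, d ∣ v → Multiset.card (L.filter (fun z => d ∣ z)) ≤ v - d

section ListPaths

theorem linDiffs_cons_cons (a b : ℕ) (t : List ℕ) :
    linDiffs (a :: b :: t) = ((a - b) + (b - a)) ::ₘ linDiffs (b :: t) := rfl

@[simp] theorem linDiffs_singleton (a : ℕ) : linDiffs [a] = 0 := rfl

theorem linDiffs_append (s : List ℕ) (a : ℕ) (t : List ℕ) :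
    linDiffs (s ++ a :: t) = linDiffs (s ++ [a]) + linDiffs (a :: t) := by
  induction s with
  | nil => simp
  | cons b s ih =>
    cases s with
    | nil => simp [linDiffs_cons_cons]
    | cons c s =>
      simp only [List.cons_append] at ih ⊢
      rw [linDiffs_cons_cons, linDiffs_cons_cons, ih, Multiset.cons_add]

theorem linDiffs_append_cons (s : List ℕ) (a b : ℕ) (t : List ℕ) :
    linDiffs (s ++ a :: b :: t) =
      linDiffs (s ++ [a]) + {(a - b) + (b - a)} + linDiffs (b :: t) := by
  rw [linDiffs_append, linDiffs_cons_cons, add_assoc, Multiset.singleton_add]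

theorem linDiffs_reverse (l : List ℕ) : linDiffs l.reverse = linDiffs l := by
  induction l with
  | nil => rfl
  | cons a l ih =>
    cases l with
    | nil => rfl
    | cons b l =>
      simp only [List.reverse_cons, List.append_assoc, List.singleton_append] at ih ⊢
      rw [linDiffs_append_cons, ih, linDiffs_cons_cons, linDiffs_singleton, add_zero, add_comm,
        Multiset.singleton_add, add_comm (a - b)]

theorem linDiffs_map_of_dist_eq {α : Type*} (f g : α → ℕ) (l : List α)
    (h : ∀ a ∈ l, ∀ b ∈ l, (f a - f b) + (f b - f a) = (g a - g b) + (g b - g a)) :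
    linDiffs (l.map f) = linDiffs (l.map g) := by
  induction l with
  | nil => rfl
  | cons a l ih =>
    cases l with
    | nil => rfl
    | cons b l =>
      have := ih fun a ha b hb => h a (by simp [ha]) b (by simp [hb])
      simp only [List.map_cons] at this ⊢
      rw [linDiffs_cons_cons, linDiffs_cons_cons, this, h a (by simp) b (by simp)]

theorem card_linDiffs (l : List ℕ) : Multiset.card (linDiffs l) = l.length - 1 := by
  simp [linDiffs]

theorem HasStandardLinearRealization.add {L M : Multiset ℕ}
    (hL : HasStandardLinearRealization L) (hM : HasStandardLinearRealization M) :
    HasLinearRealization (L + M) := by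
  obtain ⟨l, ⟨hlp, hld⟩, hl0⟩ := hL
  obtain ⟨m, ⟨hmp, hmd⟩, hm0⟩ := hM
  obtain ⟨l, rfl⟩ : ∃ t, l = 0 :: t := by
    cases l with
    | nil => simp at hl0
    | cons a t => simp at hl0; exact ⟨t, by rw [hl0]⟩
  obtain ⟨m, rfl⟩ : ∃ t, m = 0 :: t := by
    cases m with
    | nil => simp at hm0
    | cons a t => simp at hm0; exact ⟨t, by rw [hm0]⟩
  set N := Multiset.card M with hN
  have hml : ∀ k ∈ 0 :: m, k ≤ N := fun k hk => by
    have := hmp.mem_iff.1 hk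
    simp at this; omega
  refine ⟨((0 :: m).map (fun k => N - k)).reverse ++ l.map (fun k => k + N), ?_, ?_⟩
  · have h1 : (((0 :: m).map (fun k => N - k)).reverse).Perm (List.range (N + 1)) := by
      refine (List.reverse_perm _).trans ((hmp.map _).trans ?_)
      refine (List.perm_ext_iff_of_nodup ?_ List.nodup_range).2 ?_
      · refine List.Nodup.map_on ?_ List.nodup_range
        intro a ha b hb h
        simp at ha hb h; omega
      · intro a
        simp only [List.mem_map, List.mem_range]
        constructor
        · rintro ⟨b, hb, rfl⟩; omega
        · intro h; exact ⟨N - a, by omega, by omega⟩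
    have h2 : (l.map (fun k => k + N)).Perm
        ((List.range (Multiset.card L)).map (fun k => N + 1 + k)) := by
      have : l.Perm ((List.range (Multiset.card L)).map Nat.succ) := by
        rw [List.range_succ_eq_map] at hlp
        exact hlp.cons_inv
      refine (this.map _).trans (List.Perm.of_eq ?_)
      rw [List.map_map]
      exact List.map_congr_left fun k _ => by simp; omega
    refine (h1.append h2).trans (List.Perm.of_eq ?_)
    rw [Multiset.card_add, ← hN, show Multiset.card L + N + 1 = (N + 1) + Multiset.card L by ring]
    exact List.range_add.symm
  · simp only [List.map_cons, List.reverse_cons, List.append_assoc, List.singleton_append,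
      Nat.sub_zero]
    rw [linDiffs_append, add_comm]
    congr 1
    · rw [← hld, show N :: l.map (fun k => k + N) = (0 :: l).map (fun k => k + N) by simp]
      conv_rhs => rw [← List.map_id (0 :: l)]
      exact linDiffs_map_of_dist_eq _ _ _ fun a _ b _ => by simp only [id]; omega
    · rw [← hmd, ← linDiffs_reverse (0 :: m),
        show (m.map (fun k => N - k)).reverse ++ [N] = ((0 :: m).reverse).map (fun k => N - k) by
          simp]
      conv_rhs => rw [← List.map_id ((0 :: m).reverse)]
      refine linDiffs_map_of_dist_eq _ _ _ fun a ha b hb => ?_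
      have := hml a (List.mem_reverse.1 ha)
      have := hml b (List.mem_reverse.1 hb)
      simp only [id]; omega

theorem HasStandardLinearRealization.hasLinearRealization {L : Multiset ℕ}
    (h : HasStandardLinearRealization L) : HasLinearRealization L :=
  let ⟨l, hl, _⟩ := h
  ⟨l, hl⟩

theorem HasStandardLinearRealization.cons_one {L : Multiset ℕ}
    (h : HasStandardLinearRealization L) : HasStandardLinearRealization (1 ::ₘ L) := by
  obtain ⟨l, ⟨hlp, hld⟩, hl0⟩ := h
  refine ⟨0 :: l.map Nat.succ, ⟨?_, ?_⟩, rfl⟩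
  · rw [Multiset.card_cons, List.range_succ_eq_map]
    exact (hlp.map _).cons 0
  · cases l with
    | nil => simp at hl0
    | cons a t =>
      simp at hl0
      subst hl0
      rw [List.map_cons, linDiffs_cons_cons, ← List.map_cons, ← hld]
      congr 1
      conv_rhs => rw [← List.map_id (0 :: t)]
      exact linDiffs_map_of_dist_eq _ _ _ fun a _ b _ => by simp only [id]; omega

theorem HasStandardLinearRealization.mset3_mono {a a' b c x y : ℕ} (haa : a ≤ a')
    (h : HasStandardLinearRealization (mset3 a b c x y)) :
    HasStandardLinearRealization (mset3 a' b c x y) := by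
  induction haa with
  | refl => exact h
  | step _ ih =>
    have := ih.cons_one
    rwa [mset3, ← Multiset.cons_add, ← Multiset.cons_add, ← Multiset.replicate_succ] at this

end ListPaths

section Growth

/-- The numbers `p` and `p + 1` are neighbours in the list `l`. -/
def Linked (l : List ℕ) (p : ℕ) : Prop :=
  ∃ a b, [a, b] <:+: l ∧ (a = p ∧ b = p + 1 ∨ a = p + 1 ∧ b = p)

theorem pair_isInfix_append {α : Type*} {a b p : α} {s t : List α}
    (h : [a, b] <:+: s ++ p :: t) : [a, b] <:+: s ++ [p] ∨ [a, b] <:+: p :: t := by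
  induction s with
  | nil => exact Or.inr h
  | cons c s ih =>
    rw [List.cons_append, List.infix_cons_iff] at h
    rcases h with h | h
    · left
      refine List.IsPrefix.isInfix ?_
      cases s with
      | nil => simp_all [List.cons_prefix_cons]
      | cons d s => simp_all [List.cons_prefix_cons]
    · exact (ih h).imp_left fun h => List.infix_cons_iff.2 (Or.inr h)

theorem pair_isInfix_insert {α : Type*} {a b p q : α} {s t : List α} (r : List α)
    (h : [a, b] <:+: s ++ p :: q :: t) (hne : ¬ (a = p ∧ b = q)) :
    [a, b] <:+: s ++ p :: (r ++ q :: t) := by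
  rcases pair_isInfix_append h with h | h
  · exact h.trans ⟨[], r ++ q :: t, by simp⟩
  · rw [List.infix_cons_iff] at h
    rcases h with h | h
    · exact absurd (by simpa [List.cons_prefix_cons] using h) hne
    · exact h.trans ⟨s ++ p :: r, [], by simp⟩

theorem exists_insert_pair {l : List ℕ} {n p z : ℕ} (hl : l.Perm (List.range n))
    (h0 : l.head? = some 0) (hp : Linked l p) (hn : p + z = n) :
    ∃ l' : List ℕ, l'.Perm (List.range (n + 2)) ∧ l'.head? = some 0 ∧
      linDiffs l' = linDiffs l + Multiset.replicate 2 z ∧ Linked l' n ∧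
      ∀ q, q ≠ p → Linked l q → Linked l' q := by
  obtain ⟨a, b, ⟨s, t, rfl⟩, hab⟩ := hp
  obtain ⟨u, v, huv, hau, hvb, huv'⟩ : ∃ u v, [n, n + 1].Perm [u, v] ∧
      (a - u) + (u - a) = z ∧ (v - b) + (b - v) = z ∧
      (u = n ∧ v = n + 1 ∨ u = n + 1 ∧ v = n) := by
    rcases hab with ⟨rfl, rfl⟩ | ⟨rfl, rfl⟩
    · exact ⟨n, n + 1, List.Perm.refl _, by omega, by omega, by simp⟩
    · exact ⟨n + 1, n, List.Perm.swap _ _ _, by omega, by omega, by simp⟩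
  have hs : s ++ [a, b] ++ t = s ++ a :: b :: t := by simp
  rw [hs] at hl h0 ⊢
  refine ⟨s ++ a :: ([u, v] ++ b :: t), ?_, ?_, ?_, ?_, ?_⟩
  · rw [show List.range (n + 2) = List.range n ++ [n, n + 1] by
      rw [List.range_succ, List.range_succ]; simp]
    refine List.Perm.trans ?_ (hl.append huv.symm)
    rw [show s ++ a :: ([u, v] ++ b :: t) = (s ++ [a]) ++ ([u, v] ++ (b :: t)) by simp,
      show s ++ a :: b :: t ++ [u, v] = (s ++ [a]) ++ ((b :: t) ++ [u, v]) by simp]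
    exact List.perm_append_comm.append_left _
  · cases s <;> simpa using h0
  · have h1 : (a - b) + (b - a) = (u - v) + (v - u) := by omega
    simp only [List.cons_append, List.nil_append]
    rw [linDiffs_append_cons, linDiffs_append_cons, linDiffs_cons_cons, linDiffs_cons_cons, hau,
      hvb, h1]
    simp only [← Multiset.singleton_add, show Multiset.replicate 2 z = {z} + {z} from rfl]
    abel
  · exact ⟨u, v, ⟨s ++ [a], b :: t, by simp⟩, huv'⟩
  · rintro q hq ⟨c, d, hcd, hcd'⟩
    exact ⟨c, d, pair_isInfix_insert _ hcd (by omega), hcd'⟩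

/-- `l` is a standard linear realization of `M` in which the pairs `p, p + 1` filling the last
`z` positions are neighbours. -/
def IsPairedRealization (z n : ℕ) (M : Multiset ℕ) (l : List ℕ) : Prop :=
  l.Perm (List.range n) ∧ l.head? = some 0 ∧ linDiffs l = M ∧
    ∀ p, n ≤ p + z → p + 1 < n → p % 2 = n % 2 → Linked l p

theorem IsPairedRealization.mono {z z' n : ℕ} {M : Multiset ℕ} {l : List ℕ} (hz : z' ≤ z)
    (h : IsPairedRealization z n M l) : IsPairedRealization z' n M l :=
  ⟨h.1, h.2.1, h.2.2.1, fun p h1 => h.2.2.2 p (by omega)⟩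

theorem IsPairedRealization.grow {z n : ℕ} {M : Multiset ℕ} {l : List ℕ} (hz : Even z)
    (hz0 : 0 < z) (hzn : z ≤ n) (h : IsPairedRealization z n M l) (k : ℕ) :
    ∃ l', IsPairedRealization z (n + 2 * k) (M + Multiset.replicate (2 * k) z) l' := by
  induction k with
  | zero => exact ⟨l, by simpa using h⟩
  | succ k ih =>
    obtain ⟨l', h1, h2, h3, h4⟩ := ih
    obtain ⟨w, rfl⟩ := hz
    obtain ⟨l'', g1, g2, g3, g4, g5⟩ := exists_insert_pair (p := n + 2 * k - (w + w)) (z := w + w)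
      h1 h2 (h4 _ (by omega) (by omega) (by omega)) (by omega)
    refine ⟨l'', g1, g2, ?_, ?_⟩
    · rw [g3, h3, add_assoc, ← Multiset.replicate_add]
      rfl
    · intro p hp1 hp2 hp3
      rcases Nat.lt_or_ge p (n + 2 * k) with hp | hp
      · exact g5 p (by omega) (h4 p (by omega) (by omega) (by omega))
      · rwa [show p = n + 2 * k by omega]

theorem IsPairedRealization.hasStandardLinearRealization {z n : ℕ} {M : Multiset ℕ} {l : List ℕ}
    (h : IsPairedRealization z n M l) (hn : 0 < n) : HasStandardLinearRealization M := by
  refine ⟨l, ⟨?_, h.2.2.1⟩, h.2.1⟩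
  have := card_linDiffs l
  rw [h.2.2.1, h.1.length_eq, List.length_range] at this
  rw [this, Nat.sub_add_cancel hn]
  exact h.1

/-- An arithmetic run of unit steps. -/
theorem linDiffs_range' (s n : ℕ) :
    linDiffs (List.range' s (n + 1)) = Multiset.replicate n 1 := by
  induction n generalizing s with
  | zero => rfl
  | succ n ih =>
    rw [List.range'_succ, List.range'_succ, linDiffs_cons_cons, ← List.range'_succ, ih,
      Multiset.replicate_succ]
    congr 1
    omega

theorem pair_isInfix_range' {s n p : ℕ} (h1 : s ≤ p) (h2 : p + 1 < s + n) :
    [p, p + 1] <:+: List.range' s n := by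
  refine ⟨List.range' s (p - s), List.range' (p + 2) (n - (p - s) - 2), ?_⟩
  rw [show [p, p + 1] = List.range' p 2 by rfl]
  have e1 : List.range' s (p - s) ++ List.range' p 2 = List.range' s (p - s + 2) := by
    have := List.range'_append_1 (s := s) (m := p - s) (n := 2)
    rwa [show s + (p - s) = p by omega] at this
  have e2 := List.range'_append_1 (s := s) (m := p - s + 2) (n := n - (p - s) - 2)
  rw [show s + (p - s + 2) = p + 2 by omega,
    show p - s + 2 + (n - (p - s) - 2) = n by omega] at e2
  rw [e1, e2]

end Growth

section EvenRealizations

theorem mset3_add (a b c a' b' c' x y : ℕ) :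
    mset3 a b c x y + mset3 a' b' c' x y = mset3 (a + a') (b + b') (c + c') x y := by
  simp only [mset3, Multiset.replicate_add]
  abel

theorem replicate_one_eq_mset3 (a x y : ℕ) : Multiset.replicate a 1 = mset3 a 0 0 x y := by
  simp [mset3]

theorem replicate_left_eq_mset3 (b x y : ℕ) : Multiset.replicate b x = mset3 0 b 0 x y := by
  simp [mset3]

theorem replicate_right_eq_mset3 (c x y : ℕ) : Multiset.replicate c y = mset3 0 0 c x y := by
  simp [mset3]

theorem isPairedRealization_range {z : ℕ} (hz : 0 < z) :
    IsPairedRealization z z (Multiset.replicate (z - 1) 1) (List.range z) := by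
  obtain ⟨w, rfl⟩ := Nat.exists_eq_succ_of_ne_zero hz.ne'
  refine ⟨List.Perm.refl _, by simp [List.range_succ_eq_map], ?_, ?_⟩
  · rw [List.range_eq_range', linDiffs_range']
    rfl
  · intro p _ hp _
    refine ⟨p, p + 1, ?_, by simp⟩
    rw [List.range_eq_range']
    exact pair_isInfix_range' (by omega) (by omega)

theorem range_add_perm (m n : ℕ) :
    (List.range' 0 m ++ (List.range' m n).reverse).Perm (List.range (m + n)) := by
  refine ((List.reverse_perm _).append_left _).trans (List.Perm.of_eq ?_)
  rw [List.range_eq_range']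
  simpa using List.range'_append_1 (s := 0) (m := m) (n := n)

theorem pair_isInfix_reverse {α : Type*} {a b : α} {l : List α} (h : [a, b] <:+: l) :
    [b, a] <:+: l.reverse := by
  obtain ⟨s, t, rfl⟩ := h
  exact ⟨t.reverse, s.reverse, by simp⟩

theorem linked_range_append_reverse {m n p : ℕ} (hp : p + 1 < m + n) (hpm : p + 1 ≠ m) :
    Linked (List.range' 0 m ++ (List.range' m n).reverse) p := by
  rcases Nat.lt_or_ge p m with h | h
  · exact ⟨p, p + 1, (pair_isInfix_range' (by omega) (by omega)).trans
      (List.prefix_append _ _).isInfix, by simp⟩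
  · exact ⟨p + 1, p, (pair_isInfix_reverse (pair_isInfix_range' (by omega) (by omega))).trans
      (List.suffix_append _ _).isInfix, by simp⟩

theorem linDiffs_range_append_reverse (m n : ℕ) :
    linDiffs (List.range' 0 (m + 1) ++ (List.range' (m + 1) (n + 1)).reverse) =
      Multiset.replicate (m + n) 1 + {n + 1} := by
  have e1 : List.range' 0 (m + 1) = List.range' 0 m ++ [m] := by
    simp [List.range'_concat]
  have e2 : (List.range' (m + 1) (n + 1)).reverse =
      (m + 1 + n) :: (List.range' (m + 1) n).reverse := by
    simp [List.range'_concat]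
  rw [e1, e2, List.append_assoc, List.singleton_append, linDiffs_append_cons, ← e1, ← e2,
    linDiffs_reverse, linDiffs_range', linDiffs_range', Multiset.replicate_add,
    show m - (m + 1 + n) + (m + 1 + n - m) = n + 1 by omega]
  abel

theorem isPairedRealization_zero_append {z : ℕ} (hz : 0 < z) :
    (List.range' 0 1 ++ (List.range' 1 z).reverse).Perm (List.range (z + 1)) ∧
    (List.range' 0 1 ++ (List.range' 1 z).reverse).head? = some 0 ∧
    linDiffs (List.range' 0 1 ++ (List.range' 1 z).reverse) =
      Multiset.replicate (z - 1) 1 + {z} ∧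
    ∀ p, 0 < p → p < z → Linked (List.range' 0 1 ++ (List.range' 1 z).reverse) p := by
  obtain ⟨w, rfl⟩ := Nat.exists_eq_succ_of_ne_zero hz.ne'
  refine ⟨?_, rfl, ?_, ?_⟩
  · rw [add_comm _ 1]
    exact range_add_perm _ _
  · simpa using linDiffs_range_append_reverse 0 w
  · intro p h1 h2
    exact linked_range_append_reverse (by omega) (by omega)

theorem exists_isPairedRealization_of_even {z : ℕ} (hz : Even z) (hz0 : 0 < z) (b : ℕ) :
    ∃ n l, z ≤ n ∧ IsPairedRealization z n
      (Multiset.replicate (z - 1) 1 + Multiset.replicate b z) l := by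
  obtain ⟨k, rfl⟩ | ⟨k, rfl⟩ := Nat.even_or_odd b
  · obtain ⟨l, hl⟩ := (isPairedRealization_range hz0).grow hz hz0 le_rfl k
    exact ⟨z + 2 * k, l, by omega, by rwa [← two_mul]⟩
  · obtain ⟨h1, h2, h3, h4⟩ := isPairedRealization_zero_append hz0
    have h : IsPairedRealization z (z + 1) _ _ :=
      ⟨h1, h2, h3, fun p hp hp' _ => h4 p (by omega) (by omega)⟩
    obtain ⟨l, hl⟩ := h.grow hz hz0 (by omega) k
    refine ⟨z + 1 + 2 * k, l, by omega, ?_⟩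
    rw [add_comm (2 * k), Multiset.replicate_add, ← add_assoc]
    exact hl

theorem hasStandard_of_even {x : ℕ} (hx : Even x) (hx0 : 0 < x) (b : ℕ) :
    HasStandardLinearRealization (Multiset.replicate (x - 1) 1 + Multiset.replicate b x) := by
  obtain ⟨n, l, hn, h⟩ := exists_isPairedRealization_of_even hx hx0 b
  exact h.hasStandardLinearRealization (by omega)

theorem exists_isPairedRealization_single {x y : ℕ} (hx : Even x) (hy : Even y) (hx0 : 0 < x)
    (hxy : x < y) (c : ℕ) :
    ∃ n l, y ≤ n ∧ IsPairedRealization y n (mset3 (y - 1) 1 c x y) l := by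
  obtain ⟨w, rfl⟩ := Nat.exists_eq_succ_of_ne_zero hx0.ne'
  obtain ⟨d, rfl⟩ := Nat.exists_eq_add_of_lt hxy
  obtain ⟨k, rfl⟩ | ⟨k, rfl⟩ := Nat.even_or_odd c
  · have h : IsPairedRealization (w.succ + d + 1) (w.succ + d + 1 + 1)
        (mset3 (w.succ + d) 1 0 w.succ (w.succ + d + 1))
        (List.range' 0 (d + 1 + 1) ++ (List.range' (d + 1 + 1) (w + 1)).reverse) := by
      refine ⟨?_, by simp [List.range'_succ], ?_, ?_⟩
      · convert range_add_perm (d + 1 + 1) (w + 1) using 2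
        omega
      · rw [linDiffs_range_append_reverse, show d + 1 + w = w.succ + d by omega]
        simp [mset3]
      · intro p hp1 hp2 hp3
        refine linked_range_append_reverse (by omega) ?_
        obtain ⟨s, hs⟩ := hx
        obtain ⟨t, ht⟩ := hy
        omega
    obtain ⟨l, hl⟩ := h.grow hy (by omega) (by omega) k
    refine ⟨w.succ + d + 1 + 1 + 2 * k, l, by omega, ?_⟩
    rw [replicate_right_eq_mset3 _ w.succ, mset3_add] at hl
    convert hl using 2
    all_goals omega
  · have e1 : (List.range' (w + 3) (d + 1)).reverse =
        (w + 3 + d) :: (List.range' (w + 3) d).reverse := by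
      simp [List.range'_concat]
    have e2 : (List.range' (w + 3) (d + 1)).reverse =
        (List.range' (w + 4) d).reverse ++ [w + 3] := by
      simp [List.range'_succ]
    have h : IsPairedRealization (w.succ + d + 1) (w.succ + d + 1 + 2)
        (mset3 (w.succ + d) 1 1 w.succ (w.succ + d + 1))
        ([0, 1] ++ ((List.range' (w + 3) (d + 1)).reverse ++ List.range' 2 (w + 1))) := by
      refine ⟨?_, rfl, ?_, ?_⟩
      · refine ((List.perm_append_comm.trans
          ((List.reverse_perm _).append_left _)).append_left _).trans (List.Perm.of_eq ?_)
        rw [show w + 3 = 2 + (w + 1) by ring, List.range'_append_1, List.range_eq_range',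
          show w.succ + d + 1 + 2 = 2 + (w + 1 + (d + 1)) by omega]
        exact List.range'_append_1 (s := 0) (m := 2) (n := w + 1 + (d + 1))
      · have e3 : linDiffs ((List.range' (w + 3) (d + 1)).reverse ++ List.range' 2 (w + 1)) =
            Multiset.replicate d 1 + {w + 1} + Multiset.replicate w 1 := by
          rw [e2, List.append_assoc, List.range'_succ, List.singleton_append,
            linDiffs_append_cons, ← e2, linDiffs_reverse, linDiffs_range', ← List.range'_succ,
            linDiffs_range', show w + 3 - 2 + (2 - (w + 3)) = w + 1 by omega]
        rw [e1] at e3 ⊢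
        simp only [List.cons_append, List.nil_append] at e3 ⊢
        rw [linDiffs_cons_cons, linDiffs_cons_cons, e3,
          show 1 - (w + 3 + d) + (w + 3 + d - 1) = w.succ + d + 1 by omega,
          show w.succ + d = 1 + d + w by omega]
        simp only [mset3, ← Multiset.singleton_add, Multiset.replicate_add,
          Multiset.replicate_one, Nat.succ_eq_add_one]
        abel
      · intro p hp1 hp2 hp3
        obtain ⟨s, hs⟩ := hx
        obtain ⟨t, ht⟩ := hy
        rcases Nat.lt_or_ge p (w + 3) with hp | hp
        · exact ⟨p, p + 1, (pair_isInfix_range' (s := 2) (n := w + 1) (by omega)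
            (by omega)).trans
            ⟨[0, 1] ++ (List.range' (w + 3) (d + 1)).reverse, [], by simp⟩, by simp⟩
        · exact ⟨p + 1, p,
            (pair_isInfix_reverse (pair_isInfix_range' (s := w + 3) (n := d + 1)
            (by omega) (by omega))).trans ⟨[0, 1], List.range' 2 (w + 1), by simp⟩, by simp⟩
    obtain ⟨l, hl⟩ := h.grow hy (by omega) (by omega) k
    refine ⟨w.succ + d + 1 + 2 + 2 * k, l, by omega, ?_⟩
    rw [replicate_right_eq_mset3 _ w.succ, mset3_add] at hl
    convert hl using 2
    all_goals omega

theorem hasStandard_of_even_even {x y : ℕ} (hx : Even x) (hy : Even y) (hx0 : 0 < x)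
    (hxy : x < y) (b c : ℕ) :
    HasStandardLinearRealization (mset3 (y - 1) b c x y) := by
  obtain ⟨k, rfl⟩ | ⟨k, rfl⟩ := Nat.even_or_odd b
  · obtain ⟨n, l, hn, h⟩ := exists_isPairedRealization_of_even hy (by omega) c
    obtain ⟨l', h'⟩ := (h.mono hxy.le).grow hx hx0 (by omega) k
    have := h'.hasStandardLinearRealization (by omega)
    rw [replicate_one_eq_mset3 _ x y, replicate_right_eq_mset3 _ x, mset3_add,
      replicate_left_eq_mset3 _ x y, mset3_add] at this
    convert this using 2
    all_goals omega
  · obtain ⟨n, l, hn, h⟩ := exists_isPairedRealization_single hx hy hx0 hxy c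
    obtain ⟨l', h'⟩ := (h.mono hxy.le).grow hx hx0 (by omega) k
    have := h'.hasStandardLinearRealization (by omega)
    rw [replicate_left_eq_mset3 _ x y, mset3_add] at this
    convert this using 2
    all_goals omega

/-- Few long edges: fewer than `y` edges of odd length `y`, an odd number of them. -/
theorem hasStandard_of_odd_of_lt {y c : ℕ} (hy : Odd y) (hc : Odd c) (hcy : c < y) :
    HasStandardLinearRealization (Multiset.replicate (y - 1) 1 + Multiset.replicate c y) := by
  obtain ⟨m, rfl⟩ := hy
  obtain ⟨k, rfl⟩ := hc
  obtain ⟨h1, h2, h3, h4⟩ := isPairedRealization_zero_append (z := 2 * m + 1) (by omega)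
  have key : ∀ i ≤ k, ∃ l : List ℕ, l.Perm (List.range (2 * m + 1 + 1 + 2 * i)) ∧
      l.head? = some 0 ∧ linDiffs l = Multiset.replicate (2 * m + 1 - 1) 1 +
        Multiset.replicate (2 * i + 1) (2 * m + 1) ∧
      ∀ p, 2 * i < p → p < 2 * m + 1 → Linked l p := by
    intro i hi
    induction i with
    | zero => exact ⟨_, h1, h2, by simpa using h3, fun p hp => h4 p (by omega)⟩
    | succ i ih =>
      obtain ⟨l, g1, g2, g3, g4⟩ := ih (by omega)
      obtain ⟨l', f1, f2, f3, -, f5⟩ := exists_insert_pair (p := 2 * i + 1) (z := 2 * m + 1) g1 g2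
        (g4 _ (by omega) (by omega)) (by omega)
      refine ⟨l', f1, f2, ?_, fun p hp hp' => f5 p (by omega) (g4 p (by omega) hp')⟩
      rw [f3, g3, add_assoc, ← Multiset.replicate_add]
      rfl
  obtain ⟨l, g1, g2, g3, -⟩ := key k le_rfl
  refine ⟨l, ⟨?_, g3⟩, g2⟩
  convert g1 using 2
  simp
  omega

end EvenRealizations

section GridPaths

theorem linDiffs_append_of_getLast_head {l m : List ℕ} {q p d : ℕ} (hq : l.getLast? = some q)
    (hp : m.head? = some p) (hd : (q - p) + (p - q) = d) :
    linDiffs (l ++ m) = linDiffs l + {d} + linDiffs m := by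
  obtain ⟨l, rfl⟩ := List.getLast?_eq_some_iff.1 hq
  obtain ⟨m, rfl⟩ := List.head?_eq_some_iff.1 hp
  rw [List.append_assoc, List.singleton_append, linDiffs_append_cons, hd]

/-- There is a path through exactly the grid points satisfying `P`, where the point in column `i`
and row `r` stands for the number `i + r * y`, from the number `p` to the number `q`, and with
steps `1` (`a` times), `z` (`b` times) and `y`. -/
def GridPath (y z : ℕ) (P : ℕ → ℕ → Prop) (p q a b : ℕ) : Prop :=
  ∃ (l : List (ℕ × ℕ)) (c : ℕ), l.Nodup ∧ (∀ u, u ∈ l ↔ P u.1 u.2) ∧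
    (l.map fun u => u.1 + u.2 * y).head? = some p ∧
    (l.map fun u => u.1 + u.2 * y).getLast? = some q ∧
    linDiffs (l.map fun u => u.1 + u.2 * y) = mset3 a b c z y

namespace GridPath

variable {y z : ℕ} {P P' S : ℕ → ℕ → Prop} {p q p' q' a b a' b' : ℕ}

theorem single (y z i r : ℕ) :
    GridPath y z (fun i' r' => i' = i ∧ r' = r) (i + r * y) (i + r * y) 0 0 :=
  ⟨[(i, r)], 0, by simp, by simp [Prod.ext_iff], rfl, rfl, rfl⟩

theorem reverse (h : GridPath y z P p q a b) : GridPath y z P q p a b := by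
  obtain ⟨l, c, h1, h2, h3, h4, h5⟩ := h
  refine ⟨l.reverse, c, List.nodup_reverse.2 h1, fun u => by rw [List.mem_reverse, h2], ?_, ?_, ?_⟩
  · rw [List.map_reverse, List.head?_reverse, h4]
  · rw [List.map_reverse, List.getLast?_reverse, h3]
  · rw [List.map_reverse, linDiffs_reverse, h5]

theorem congr (h : GridPath y z P p q a b) (hS : ∀ i r, S i r ↔ P i r) (hp : p = p') (hq : q = q')
    (ha : a = a') (hb : b = b') : GridPath y z S p' q' a' b' := by
  subst hp hq ha hb
  obtain ⟨l, c, h1, h2, h3⟩ := h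
  exact ⟨l, c, h1, fun u => by rw [h2, hS], h3⟩

theorem exists_append {d : ℕ} (h : GridPath y z P p q a b) (h' : GridPath y z P' p' q' a' b')
    (hd : q + d = p' ∨ p' + d = q) (hP : ∀ i r, P i r → ¬ P' i r)
    (hS : ∀ i r, S i r ↔ P i r ∨ P' i r) :
    ∃ (l : List (ℕ × ℕ)) (c : ℕ), l.Nodup ∧ (∀ u, u ∈ l ↔ S u.1 u.2) ∧
      (l.map fun u => u.1 + u.2 * y).head? = some p ∧
      (l.map fun u => u.1 + u.2 * y).getLast? = some q' ∧
      linDiffs (l.map fun u => u.1 + u.2 * y) = {d} + mset3 (a + a') (b + b') c z y := by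
  obtain ⟨l, c, h1, h2, h3, h4, h5⟩ := h
  obtain ⟨l', c', h1', h2', h3', h4', h5'⟩ := h'
  refine ⟨l ++ l', c + c', ?_, ?_, ?_, ?_, ?_⟩
  · rw [List.nodup_append']
    refine ⟨h1, h1', fun u hu hu' => hP _ _ ((h2 u).1 hu) ((h2' u).1 hu')⟩
  · intro u
    rw [List.mem_append, h2, h2', hS]
  · rw [List.map_append, List.head?_append, h3]
    rfl
  · rw [List.map_append, List.getLast?_append, h4']
    rfl
  · rw [List.map_append, linDiffs_append_of_getLast_head h4 h3' (d := d) (by omega), h5, h5',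
      ← mset3_add]
    abel

theorem append_one (h : GridPath y z P p q a b) (h' : GridPath y z P' p' q' a' b')
    (hd : q + 1 = p' ∨ p' + 1 = q) (hP : ∀ i r, P i r → ¬ P' i r)
    (hS : ∀ i r, S i r ↔ P i r ∨ P' i r) : GridPath y z S p q' (a + a' + 1) (b + b') := by
  obtain ⟨l, c, h1, h2, h3, h4, h5⟩ := exists_append h h' hd hP hS
  refine ⟨l, c, h1, h2, h3, h4, ?_⟩
  rw [h5, mset3, mset3, Multiset.replicate_succ, ← Multiset.singleton_add]
  abel

theorem append_jump (h : GridPath y z P p q a b) (h' : GridPath y z P' p' q' a' b')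
    (hd : q + z = p' ∨ p' + z = q) (hP : ∀ i r, P i r → ¬ P' i r)
    (hS : ∀ i r, S i r ↔ P i r ∨ P' i r) : GridPath y z S p q' (a + a') (b + b' + 1) := by
  obtain ⟨l, c, h1, h2, h3, h4, h5⟩ := exists_append h h' hd hP hS
  refine ⟨l, c, h1, h2, h3, h4, ?_⟩
  rw [h5, mset3, mset3, Multiset.replicate_succ, ← Multiset.singleton_add]
  abel

theorem append_vertical (h : GridPath y z P p q a b) (h' : GridPath y z P' p' q' a' b')
    (hd : q + y = p' ∨ p' + y = q) (hP : ∀ i r, P i r → ¬ P' i r)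
    (hS : ∀ i r, S i r ↔ P i r ∨ P' i r) : GridPath y z S p q' (a + a') (b + b') := by
  obtain ⟨l, c, h1, h2, h3, h4, h5⟩ := exists_append h h' hd hP hS
  refine ⟨l, c + 1, h1, h2, h3, h4, ?_⟩
  rw [h5, mset3, mset3, Multiset.replicate_succ, ← Multiset.singleton_add]
  abel

theorem column (y z s : ℕ) {r₁ r₂ : ℕ} (h : r₁ ≤ r₂) :
    GridPath y z (fun i r => i = s ∧ r₁ ≤ r ∧ r ≤ r₂) (s + r₁ * y) (s + r₂ * y) 0 0 := by
  induction r₂, h using Nat.le_induction with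
  | base =>
    exact (single y z s r₁).congr (fun i r => by omega) rfl rfl rfl rfl
  | succ r₂ h ih =>
    exact ih.append_vertical (single y z s (r₂ + 1)) (by left; ring) (fun i r => by omega)
      (fun i r => by omega)

theorem full_column (y z s : ℕ) (T : ℕ → ℕ) :
    GridPath y z (fun i r => i = s ∧ r ≤ T i) s (s + T s * y) 0 0 := by
  refine (column y z s (Nat.zero_le (T s))).congr (fun i r => ?_) (by simp) rfl rfl rfl
  constructor
  · rintro ⟨rfl, h⟩
    exact ⟨rfl, Nat.zero_le _, h⟩
  · rintro ⟨rfl, -, h⟩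
    exact ⟨rfl, h⟩

theorem snake_right (y z : ℕ) {T : ℕ → ℕ} (hT : ∀ k, T (2 * k + 1) = T (2 * k)) (k : ℕ) :
    GridPath y z (fun i r => i ≤ 2 * k ∧ r ≤ T i) 0 (2 * k + T (2 * k) * y) (2 * k) 0 := by
  induction k with
  | zero => exact (full_column y z 0 T).congr (fun i r => by omega) rfl rfl rfl rfl
  | succ k ih =>
    have h1 := ih.append_one (full_column y z (2 * k + 1) T).reverse (S := fun i r =>
      i ≤ 2 * k + 1 ∧ r ≤ T i) (by rw [hT]; left; ring) (fun i r => by omega) (fun i r => by omega)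
    exact h1.append_one (full_column y z (2 * k + 2) T) (Or.inl rfl) (fun i r => by omega)
      (fun i r => by omega)

theorem snake_left {y : ℕ} (z : ℕ) {T : ℕ → ℕ} (hT : ∀ k, T (2 * k + 3) = T (2 * k + 2))
    (hTy : T 0 = T y + 1) (k m : ℕ) (hk : 2 * m + 1 + 2 * k = y) :
    GridPath y z (fun i r => (i = 0 ∨ 2 * m + 1 ≤ i ∧ i < y) ∧ r ≤ T i) 0
      (2 * m + 1 + T (2 * m + 1) * y) (2 * k) 0 := by
  induction k generalizing m with
  | zero =>
    refine (full_column y z 0 T).congr (fun i r => by omega) rfl ?_ rfl rfl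
    rw [hTy, show 2 * m + 1 = y by omega]
    ring
  | succ k ih =>
    have h1 := (ih (m + 1) (by omega)).append_one (full_column y z (2 * m + 2) T).reverse
      (S := fun i r => (i = 0 ∨ 2 * m + 2 ≤ i ∧ i < y) ∧ r ≤ T i)
      (by right; rw [show 2 * (m + 1) + 1 = 2 * m + 3 by ring, hT]; ring)
      (fun i r => by omega) (fun i r => by omega)
    exact h1.append_one (full_column y z (2 * m + 1) T) (Or.inr rfl) (fun i r => by omega)
      (fun i r => by omega)

theorem extend_right {T : ℕ → ℕ} (hT : ∀ k, T (2 * k + 1) = T (2 * k)) {s : ℕ}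
    (h : GridPath y z P p (2 * s + 1) a b) (k : ℕ)
    (hP : ∀ i r, P i r → ¬ (2 * s + 1 < i ∧ i ≤ 2 * s + 1 + 2 * k ∧ r ≤ T i)) :
    GridPath y z (fun i r => P i r ∨ (2 * s + 1 < i ∧ i ≤ 2 * s + 1 + 2 * k ∧ r ≤ T i)) p
      (2 * s + 1 + 2 * k) (a + 2 * k) b := by
  induction k with
  | zero => exact h.congr (fun i r => by grind) rfl rfl rfl rfl
  | succ k ih =>
    have h1 := (ih fun i r hi => by grind).append_one
      (full_column y z (2 * (s + k + 1)) T) (S := fun i r =>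
        P i r ∨ (2 * s + 1 < i ∧ i ≤ 2 * s + 2 + 2 * k ∧ r ≤ T i)) (by omega)
      (fun i r => by grind) (fun i r => by grind)
    have h2 := h1.append_one (full_column y z (2 * (s + k + 1) + 1) T).reverse (S := fun i r =>
        P i r ∨ (2 * s + 1 < i ∧ i ≤ 2 * s + 3 + 2 * k ∧ r ≤ T i)) (by rw [hT]; left; ring)
      (fun i r => by grind) (fun i r => by grind)
    exact h2.congr (fun i r => by grind) rfl (by ring) (by ring) rfl

theorem extend_left {T : ℕ → ℕ} (hT : ∀ k, T (2 * k + 1) = T (2 * k)) {t k : ℕ}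
    (h : GridPath y z P p (2 * t + 2 * k) a b)
    (hP : ∀ i r, P i r → ¬ (2 * t ≤ i ∧ i < 2 * t + 2 * k ∧ r ≤ T i)) :
    GridPath y z (fun i r => P i r ∨ (2 * t ≤ i ∧ i < 2 * t + 2 * k ∧ r ≤ T i)) p
      (2 * t) (a + 2 * k) b := by
  induction k generalizing P a with
  | zero => exact h.congr (fun i r => by grind) rfl rfl rfl rfl
  | succ k ih =>
    have h1 := h.append_one (full_column y z (2 * (t + k) + 1) T) (S := fun i r =>
        P i r ∨ (2 * t + 2 * k + 1 = i ∧ r ≤ T i)) (by omega)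
      (fun i r => by grind) (fun i r => by grind)
    have h2 := h1.append_one (full_column y z (2 * (t + k)) T).reverse (S := fun i r =>
        P i r ∨ (2 * t + 2 * k ≤ i ∧ i < 2 * t + 2 * k + 2 ∧ r ≤ T i)) (by rw [hT]; right; ring)
      (fun i r => by grind) (fun i r => by grind)
    exact (ih (h2.congr (fun _ _ => Iff.rfl) rfl (by ring) rfl rfl)
      (fun i r => by grind)).congr (fun i r => by grind) rfl rfl (by ring) rfl

theorem hasStandardLinearRealization {n c : ℕ} (h : GridPath y z P 0 q a b)
    (hP : ∀ i r, P i r ↔ i < y ∧ i + r * y < n) (hn : a + b + c + 1 = n) :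
    HasStandardLinearRealization (mset3 a b c z y) := by
  obtain ⟨l, c', h1, h2, h3, h4, h5⟩ := h
  have key : (l.map fun u => u.1 + u.2 * y).Perm (List.range n) := by
    refine (List.perm_ext_iff_of_nodup ?_ List.nodup_range).2 ?_
    · refine h1.map_on ?_
      rintro ⟨i, r⟩ hu ⟨i', r'⟩ hu' he
      have hi := ((hP _ _).1 ((h2 _).1 hu)).1
      have hi' := ((hP _ _).1 ((h2 _).1 hu')).1
      simp only at hi hi' he
      have e1 : i = i' := by
        have := congrArg (· % y) he
        simpa [Nat.mod_eq_of_lt hi, Nat.mod_eq_of_lt hi'] using this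
      subst e1
      have : r = r' := Nat.eq_of_mul_eq_mul_right (by omega) (Nat.add_left_cancel he)
      rw [this]
    · intro k
      simp only [List.mem_map, List.mem_range]
      constructor
      · rintro ⟨u, hu, rfl⟩
        exact ((hP _ _).1 ((h2 _).1 hu)).2
      · intro hk
        have hy : 0 < y := by
          cases l with
          | nil => simp at h3
          | cons u l => exact (Nat.zero_le _).trans_lt ((hP _ _).1 ((h2 u).1 (by simp))).1
        have e := Nat.mod_add_div' k y
        exact ⟨(k % y, k / y), (h2 _).2 ((hP _ _).2 ⟨Nat.mod_lt _ hy, by simpa [e] using hk⟩), e⟩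
  have hc := card_linDiffs (l.map fun u => u.1 + u.2 * y)
  rw [key.length_eq, h5, List.length_range] at hc
  simp only [mset3, Multiset.card_add, Multiset.card_replicate] at hc
  obtain rfl : c' = c := by omega
  refine ⟨_, ⟨?_, h5⟩, h3⟩
  simp only [mset3, Multiset.card_add, Multiset.card_replicate]
  rwa [hn]

end GridPath

end GridPaths

section OddRealizations

/-- The topmost row of column `i` when `R` columns have height `w + 1` and the others height `w`. -/
def topRow (w R i : ℕ) : ℕ := if i < R then w + 1 else w

theorem topRow_of_lt {w R i : ℕ} (h : i < R) : topRow w R i = w + 1 := if_pos h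

theorem topRow_of_le {w R i : ℕ} (h : R ≤ i) : topRow w R i = w := if_neg h.not_gt

theorem le_topRow (w R i : ℕ) : w ≤ topRow w R i := by
  unfold topRow
  split <;> omega

theorem topRow_two_mul_add_one (w : ℕ) {R : ℕ} (hR : Even R) (k : ℕ) :
    topRow w R (2 * k + 1) = topRow w R (2 * k) := by
  obtain ⟨s, rfl⟩ := hR
  unfold topRow
  congr 1
  simp only [eq_iff_iff]
  omega

theorem le_topRow_iff {y w R i r : ℕ} (hR : R ≤ y) (hi : i < y) :
    r ≤ topRow w R i ↔ i + r * y < (w + 1) * y + R := by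
  rcases Nat.lt_trichotomy r (w + 1) with h | rfl | h
  · have := Nat.mul_le_mul_right y (Nat.succ_le_iff.2 h)
    rw [Nat.succ_mul] at this
    have := le_topRow w R i
    omega
  · unfold topRow
    split <;> omega
  · have := Nat.mul_le_mul_right y (Nat.succ_le_iff.2 h)
    rw [Nat.succ_mul] at this
    unfold topRow
    split <;> omega

theorem GridPath.hasStandard_of_topRow {y z q a b c w R : ℕ} {P : ℕ → ℕ → Prop}
    (h : GridPath y z P 0 q a b) (hR : R ≤ y) (hP : ∀ i r, P i r ↔ i < y ∧ r ≤ topRow w R i)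
    (hn : a + b + c + 1 = (w + 1) * y + R) : HasStandardLinearRealization (mset3 a b c z y) :=
  h.hasStandardLinearRealization
    (fun i r => (hP i r).trans (and_congr_right fun hi => le_topRow_iff hR hi)) hn

theorem hasStandard_of_odd_of_even_mod {y c : ℕ} (hy : Odd y) (hc : Even (c % y)) :
    HasStandardLinearRealization (Multiset.replicate (y - 1) 1 + Multiset.replicate c y) := by
  obtain ⟨k, rfl⟩ := hy
  have h := GridPath.snake_right (2 * k + 1) 0 (topRow_two_mul_add_one (c / (2 * k + 1)) hc) k
  have hd := Nat.div_add_mod' c (2 * k + 1)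
  have := h.hasStandard_of_topRow (c := c) (Nat.mod_lt _ (by omega)).le
    (fun i r => by rw [Nat.lt_succ_iff]) (by rw [Nat.add_mul]; omega)
  simpa [mset3] using this

theorem hasStandard_of_odd_of_mod_eq_one {y c : ℕ} (hy : Odd y) (hy1 : 1 < y)
    (hc : c % y = 1) :
    HasStandardLinearRealization (Multiset.replicate (y - 1) 1 + Multiset.replicate c y) := by
  obtain ⟨k, rfl⟩ := hy
  have h := GridPath.snake_left (y := 2 * k + 1) 0 (T := topRow (c / (2 * k + 1)) 1)
    (fun k => by rw [topRow_of_le (by omega), topRow_of_le (by omega)])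
    (by rw [topRow_of_lt (by omega), topRow_of_le (by omega)]) k 0 (by omega)
  have hd := Nat.div_add_mod' c (2 * k + 1)
  rw [hc] at hd
  have := h.hasStandard_of_topRow (c := c) (w := c / (2 * k + 1)) (R := 1) (by omega)
    (fun i r => by omega)
    (by rw [Nat.add_mul]; omega)
  simpa [mset3] using this

theorem hasStandard_single_of_odd {y z c : ℕ} (hy : Odd y) (hz : 1 ≤ z) (hzy : z < y)
    (hc : Odd (c % y)) (hcy : y ≤ c) : HasStandardLinearRealization (mset3 (y - 1) 1 c z y) := by
  have hmod := Nat.mod_lt c (by omega : 0 < y)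
  have hd := Nat.div_add_mod' c y
  obtain ⟨w, hw⟩ : ∃ w, c / y = w + 1 :=
    Nat.exists_eq_add_of_le' (Nat.div_pos hcy (by omega))
  obtain ⟨m, hm⟩ := hc
  rw [hm] at hmod hd
  rw [hw] at hd
  have hR : Even (2 * m + 2) := ⟨m + 1, by ring⟩
  have hT := topRow_two_mul_add_one (w + 1) hR
  have hle := le_topRow (w + 1) (2 * m + 2)
  have hRy : 2 * m + 2 < y := by
    obtain ⟨s, rfl⟩ := hy
    omega
  have hTlast : topRow (w + 1) (2 * m + 2) (y - 1) = w + 1 := topRow_of_le (by omega)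
  have hTzero : topRow (w + 1) (2 * m + 2) 0 = w + 1 + 1 := topRow_of_lt (by omega)
  have hTone : topRow (w + 1) (2 * m + 2) 1 = w + 1 + 1 := topRow_of_lt (by omega)
  have hTy : topRow (w + 1) (2 * m + 2) y = w + 1 := topRow_of_le (by omega)
  suffices ∃ q P, GridPath y z P 0 q (y - 1) 1 ∧
      ∀ i r, P i r ↔ i < y ∧ r ≤ topRow (w + 1) (2 * m + 2) i by
    obtain ⟨q, P, h, hP⟩ := this
    refine h.hasStandard_of_topRow hRy.le hP ?_
    rw [Nat.add_mul, hd.symm]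
    omega
  generalize topRow (w + 1) (2 * m + 2) = T at hT hle hTlast hTzero hTone hTy
  obtain ⟨s, rfl⟩ := hy
  obtain ⟨t, rfl⟩ | ⟨t, rfl⟩ := Nat.even_or_odd z
  · obtain ⟨k, rfl⟩ : ∃ k, s = k + t := Nat.exists_eq_add_of_le' (by omega)
    have h1 := GridPath.snake_left (y := 2 * (k + t) + 1) (t + t) (fun k => hT (k + 1))
      (by rw [hTzero, hTy]) (t - 1) (k + 1) (by omega)
    have h2 := h1.append_one (GridPath.column _ _ (2 * (k + 1)) (hle (2 * (k + 1)))).reverse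
      (S := fun i r => (i = 0 ∨ 2 * (k + 1) + 1 ≤ i ∧ i < 2 * (k + t) + 1) ∧ r ≤ T i ∨
        i = 2 * (k + 1) ∧ w + 1 ≤ r ∧ r ≤ T (2 * (k + 1)))
      (by right; rw [hT]; ring) (fun i r => by omega) (fun i r => by omega)
    have h3 := h2.append_jump (GridPath.full_column _ _ 1 T).reverse
      (S := fun i r => (i ≤ 1 ∨ 2 * (k + 1) + 1 ≤ i ∧ i < 2 * (k + t) + 1) ∧ r ≤ T i ∨
        i = 2 * (k + 1) ∧ w + 1 ≤ r ∧ r ≤ T (2 * (k + 1)))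
      (by left; rw [hTone]; ring) (fun i r => by omega) (fun i r => by omega)
    have h4 := GridPath.extend_right hT (s := 0) h3 k (fun i r => by omega)
    have h5 := h4.append_one (GridPath.column _ _ (2 * (k + 1)) (Nat.zero_le w))
      (S := fun i r => i < 2 * (k + t) + 1 ∧ r ≤ T i)
      (by omega) (fun i r => by omega) (fun i r => by
        have := hle i
        obtain rfl | hi := eq_or_ne i (2 * (k + 1)) <;> omega)
    exact ⟨_, _, h5.congr (fun _ _ => Iff.rfl) rfl rfl (by omega) rfl, fun _ _ => Iff.rfl⟩
  · obtain ⟨k, rfl⟩ : ∃ k, s = k + t + 1 := ⟨s - t - 1, by omega⟩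
    have h1 := GridPath.snake_right (2 * (k + t + 1) + 1) (2 * t + 1) hT k
    have h2 := h1.append_one (GridPath.column _ _ (2 * k + 1) (hle (2 * k + 1))).reverse
      (S := fun i r => i ≤ 2 * k ∧ r ≤ T i ∨ i = 2 * k + 1 ∧ w + 1 ≤ r ∧ r ≤ T (2 * k + 1))
      (by left; rw [hT]; ring) (fun i r => by omega) (fun i r => by omega)
    have h3 := h2.append_jump (GridPath.full_column _ _ (2 * (k + t + 1)) T).reverse
      (S := fun i r => (i ≤ 2 * k ∨ i = 2 * (k + t + 1)) ∧ r ≤ T i ∨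
        i = 2 * k + 1 ∧ w + 1 ≤ r ∧ r ≤ T (2 * k + 1))
      (by left; rw [show T (2 * (k + t + 1)) = w + 1 from hTlast]; ring)
      (fun i r => by omega) (fun i r => by omega)
    have h4 := GridPath.extend_left hT (t := k + 1) (k := t)
      (h3.congr (fun _ _ => Iff.rfl) rfl (by ring) rfl rfl) (fun i r => by omega)
    have h5 := h4.append_one (GridPath.column _ _ (2 * k + 1) (Nat.zero_le w))
      (S := fun i r => i < 2 * (k + t + 1) + 1 ∧ r ≤ T i)
      (by omega) (fun i r => by omega) (fun i r => by
        have := hle i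
        obtain rfl | hi := eq_or_ne i (2 * k + 1) <;> omega)
    exact ⟨_, _, h5.congr (fun _ _ => Iff.rfl) rfl rfl (by omega) rfl, fun _ _ => Iff.rfl⟩

end OddRealizations

section Combination

theorem hasStandard_pair {x a : ℕ} (b : ℕ) (hx : 1 < x) (ha : x - 1 ≤ a)
    (hxa : Even x ∨ x = 3 ∨ x ≤ a) :
    HasStandardLinearRealization (Multiset.replicate a 1 + Multiset.replicate b x) := by
  have mono : ∀ {a'}, a' ≤ a →
      HasStandardLinearRealization (Multiset.replicate a' 1 + Multiset.replicate b x) →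
      HasStandardLinearRealization (Multiset.replicate a 1 + Multiset.replicate b x) := by
    intro a' h h'
    have : HasStandardLinearRealization (mset3 a' b 0 x 0) := by simpa [mset3] using h'
    simpa [mset3] using this.mset3_mono h
  obtain he | ho := Nat.even_or_odd x
  · exact mono ha (hasStandard_of_even he (by omega) b)
  obtain hb | hb := Nat.even_or_odd (b % x)
  · exact mono ha (hasStandard_of_odd_of_even_mod ho hb)
  obtain hbx | hbx := Nat.lt_or_ge b x
  · exact mono ha (hasStandard_of_odd_of_lt ho (by rwa [Nat.mod_eq_of_lt hbx] at hb) hbx)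
  obtain rfl | h3 := eq_or_ne x 3
  · obtain ⟨k, hk⟩ := hb
    exact mono ha (hasStandard_of_odd_of_mod_eq_one ho hx (by omega))
  · have hxa : x ≤ a := by
      rcases hxa with h | h | h
      · exact absurd h (Nat.not_even_iff_odd.2 ho)
      · exact absurd h h3
      · exact h
    refine mono hxa ?_
    have := hasStandard_single_of_odd ho le_rfl hx hb hbx
    rwa [mset3, ← Multiset.replicate_add, Nat.sub_add_cancel hx.le] at this

theorem hasStandard_or_of_odd {x y : ℕ} (c : ℕ) (hy : Odd y) (hx : 1 ≤ x) (hxy : x < y) :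
    HasStandardLinearRealization (mset3 (y - 1) 0 c x y) ∨
      HasStandardLinearRealization (mset3 (y - 1) 1 c x y) := by
  obtain hc | hc := Nat.even_or_odd (c % y)
  · left
    simpa [mset3] using hasStandard_of_odd_of_even_mod hy hc
  obtain hcy | hcy := Nat.lt_or_ge c y
  · left
    simpa [mset3] using hasStandard_of_odd_of_lt hy (by rwa [Nat.mod_eq_of_lt hcy] at hc) hcy
  · exact Or.inr (hasStandard_single_of_odd hy hx hxy hc hcy)

theorem hasLinearRealization_of_fBHR_le {a b x y : ℕ} (c : ℕ) (hx : 1 < x) (hxy : x < y)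
    (hb : 1 ≤ b) (ha : fBHR x y ≤ a) : HasLinearRealization (mset3 a b c x y) := by
  have left : ∀ {a'} b', x - 1 ≤ a' → (Even x ∨ x = 3 ∨ x ≤ a') →
      HasStandardLinearRealization (mset3 a' b' 0 x y) := by
    intro a' b' h1 h2
    simpa [mset3] using hasStandard_pair b' hx h1 h2
  have key : y - 1 + (x - 1) ≤ a → (Even x ∨ x = 3 ∨ y - 1 + x ≤ a) →
      HasLinearRealization (mset3 a b c x y) := by
    intro h1 h2
    have h2' : Even x ∨ x = 3 ∨ x ≤ a - (y - 1) :=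
      h2.imp_right (Or.imp_right fun h => by omega)
    obtain hy | hy := Nat.even_or_odd y
    · have hr : HasStandardLinearRealization (mset3 (y - 1) 0 c x y) := by
        simpa [mset3] using hasStandard_of_even hy (by omega) c
      have := (left b (by omega) h2').add hr
      rwa [mset3_add, Nat.sub_add_cancel (by omega), Nat.add_zero, Nat.zero_add] at this
    · obtain hr | hr := hasStandard_or_of_odd c hy hx.le hxy
      · have := (left b (by omega) h2').add hr
        rwa [mset3_add, Nat.sub_add_cancel (by omega), Nat.add_zero, Nat.zero_add] at this
      · have := (left (b - 1) (by omega) h2').add hr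
        rwa [mset3_add, Nat.sub_add_cancel (by omega), Nat.sub_add_cancel hb,
          Nat.zero_add] at this
  unfold fBHR at ha
  split_ifs at ha with h1 h2
  · exact ((hasStandard_of_even_even h1.1 h1.2 (by omega) hxy b c).mset3_mono
      ha).hasLinearRealization
  · exact key (by omega) (h2.symm.imp And.left Or.inl)
  · exact key (by omega) (Or.inr (Or.inr (by omega)))

end Combination

section Cyclic

theorem HasLinearRealization.isRealizable {v : ℕ} {L : Multiset ℕ} (h : HasLinearRealization L)
    (hv : Multiset.card L + 1 = v) (hL : ∀ z ∈ L, z ≤ v / 2) : IsRealizable v L := by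
  obtain ⟨l, hl, rfl⟩ := h
  rw [hv] at hl
  refine ⟨l, hl, ?_⟩
  clear hl hv
  induction l with
  | nil => rfl
  | cons p l ih =>
    cases l with
    | nil => rfl
    | cons q l =>
      rw [linDiffs_cons_cons] at hL ⊢
      have hd := hL _ (Multiset.mem_cons_self _ _)
      rw [← ih fun z hz => hL z (Multiset.mem_cons_of_mem hz)]
      change min _ _ ::ₘ cycDiffs v (q :: l) = _
      rw [min_eq_left (by omega)]

/-- Multiplication by a unit modulo `v`, on edge-lengths. -/
theorem reducedForm_mul_mod_eq {v u p q : ℕ} (hp : p < v) (hq : q < v) :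
    min ((u * p % v - u * q % v) + (u * q % v - u * p % v))
      (v - ((u * p % v - u * q % v) + (u * q % v - u * p % v))) =
    reducedForm v ((u * min ((p - q) + (q - p)) (v - ((p - q) + (q - p)))) % v) := by
  have aux : ∀ r s m : ℕ, r < v → s < v → m < v → ((m : ℤ) ≡ r - s [ZMOD v] ∨
      (m : ℤ) ≡ s - r [ZMOD v]) →
      min ((r - s) + (s - r)) (v - ((r - s) + (s - r))) = min m (v - m) := by
    intro r s m hr hs hm h
    rcases h with h | h <;> obtain ⟨t, ht⟩ := h.dvd
    · have h1 : -2 < t := by nlinarith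
      have h2 : t < 2 := by nlinarith
      interval_cases t <;> omega
    · have h1 : -2 < t := by nlinarith
      have h2 : t < 2 := by nlinarith
      interval_cases t <;> omega
  have hv : 0 < v := by omega
  refine aux _ _ _ (Nat.mod_lt _ hv) (Nat.mod_lt _ hv) (Nat.mod_lt _ hv) ?_
  set d := min ((p - q) + (q - p)) (v - ((p - q) + (q - p))) with hd
  have h : ((d : ℤ) ≡ p - q [ZMOD v]) ∨ ((d : ℤ) ≡ q - p [ZMOD v]) := by
    have : (d : ℤ) = p - q ∨ (d : ℤ) = q - p ∨ (d : ℤ) = p - q + v ∨ (d : ℤ) = q - p + v := by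
      omega
    rcases this with h | h | h | h <;> rw [h] <;> simp [Int.ModEq]
  have e : ∀ k : ℕ, ((u * k % v : ℕ) : ℤ) ≡ u * k [ZMOD v] := fun k => by
    push_cast
    exact Int.mod_modEq _ _
  refine h.imp (fun h => ?_) (fun h => ?_)
  · refine (e d).trans ((h.mul_left u).trans ?_)
    rw [mul_sub]
    exact ((e p).sub (e q)).symm
  · refine (e d).trans ((h.mul_left u).trans ?_)
    rw [mul_sub]
    exact ((e q).sub (e p)).symm

theorem reducedForm_mul_mod_reducedForm {v u g : ℕ} (hg : g < v) :
    reducedForm v (u * reducedForm v g % v) = reducedForm v (u * g % v) := by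
  simpa [reducedForm] using
    (reducedForm_mul_mod_eq (u := u) hg ((Nat.zero_le g).trans_lt hg)).symm

theorem IsRealizable.map_mul {v u : ℕ} {L : Multiset ℕ} (h : IsRealizable v L)
    (hu : Nat.Coprime v u) :
    IsRealizable v (L.map fun d => reducedForm v (u * d % v)) := by
  obtain ⟨l, hl, rfl⟩ := h
  have hlt : ∀ p ∈ l, p < v := fun p hp => List.mem_range.1 (hl.mem_iff.1 hp)
  refine ⟨l.map fun p => u * p % v, ?_, ?_⟩
  · have hnd : (l.map fun p => u * p % v).Nodup := by
      refine List.Nodup.map_on ?_ (hl.nodup_iff.2 List.nodup_range)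
      intro p hp q hq h
      have : p ≡ q [MOD v] := Nat.ModEq.cancel_left_of_coprime hu h
      exact this.eq_of_lt_of_lt (hlt p hp) (hlt q hq)
    refine (hnd.subperm fun p hp => ?_).perm_of_length_le ?_
    · obtain ⟨q, hq, rfl⟩ := List.mem_map.1 hp
      exact List.mem_range.2 (Nat.mod_lt _ ((Nat.zero_le _).trans_lt (hlt q hq)))
    · simp [hl.length_eq]
  · clear hl
    induction l with
    | nil => rfl
    | cons p l ih =>
      cases l with
      | nil => rfl
      | cons q l =>
        have ih := ih fun r hr => hlt r (List.mem_cons_of_mem _ hr)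
        change min _ _ ::ₘ cycDiffs v ((q :: l).map _) = (min _ _ ::ₘ cycDiffs v (q :: l)).map _
        rw [ih, Multiset.map_cons, reducedForm_mul_mod_eq (hlt p (by simp)) (hlt q (by simp))]

theorem map_mset3 (φ : ℕ → ℕ) (a b c x y : ℕ) :
    (mset3 a b c x y).map φ = Multiset.replicate a (φ 1) + Multiset.replicate b (φ x) +
      Multiset.replicate c (φ y) := by
  simp [mset3]

theorem isRealizable_of_fBHR_le {v a b c x y : ℕ} (hx : 1 < x) (hxy : x < y) (hy : y ≤ v / 2)
    (hb : 1 ≤ b) (habc : a + b + c + 1 = v) (ha : fBHR x y ≤ a) :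
    IsRealizable v (mset3 a b c x y) := by
  refine (hasLinearRealization_of_fBHR_le c hx hxy hb ha).isRealizable ?_ ?_
  · simpa [mset3] using habc
  · intro z hz
    simp only [mset3, Multiset.mem_add, Multiset.mem_replicate] at hz
    omega

theorem mset3_swap (a b c x y : ℕ) : mset3 a b c x y = mset3 a c b y x := by
  simp only [mset3]
  abel

theorem isRealizable_of_fBHR_min_max_le {v a b c x y : ℕ} (hx : 1 < x) (hy : 1 < y)
    (hne : x ≠ y) (hxv : x ≤ v / 2) (hyv : y ≤ v / 2) (hb : 1 ≤ b) (hc : 1 ≤ c)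
    (habc : a + b + c + 1 = v) (ha : fBHR (min x y) (max x y) ≤ a) :
    IsRealizable v (mset3 a b c x y) := by
  obtain h | h := Nat.lt_or_gt_of_ne hne
  · rw [min_eq_left h.le, max_eq_right h.le] at ha
    exact isRealizable_of_fBHR_le hx h hyv hb habc ha
  · rw [min_eq_right h.le, max_eq_left h.le] at ha
    rw [mset3_swap]
    exact isRealizable_of_fBHR_le hy h hxv hc (by omega) ha

/-- Solutions `h` and `k` of `u * h ≡ w` and `u * k ≡ 1` modulo `v` transport the sufficient
condition for realizability from `{1 ^ a, ĥ ^ b, k̂ ^ c}` to `{u ^ a, w ^ b, 1 ^ c}`. -/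
theorem isRealizable_of_mul_mod {v u w h k a b c : ℕ} (hu : 1 < u) (hw : 1 < w) (huw : u ≠ w)
    (huv : u ≤ v / 2) (hwv : w ≤ v / 2) (hg : Nat.gcd v u = 1)
    (hh : 1 ≤ h ∧ h ≤ v - 1 ∧ (u * h) % v = w % v)
    (hk : 1 ≤ k ∧ k ≤ v - 1 ∧ (u * k) % v = 1 % v)
    (hb : 1 ≤ b) (hc : 1 ≤ c) (habc : a + b + c + 1 = v)
    (ha : fBHR (min (reducedForm v h) (reducedForm v k))
      (max (reducedForm v h) (reducedForm v k)) ≤ a) :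
    IsRealizable v
      (Multiset.replicate a u + Multiset.replicate b w + Multiset.replicate c 1) := by
  have e : ∀ {g m : ℕ}, g ≤ v - 1 → m ≤ v / 2 → (u * g) % v = m % v →
      reducedForm v (u * reducedForm v g % v) = m := by
    intro g m hg hm h
    rw [reducedForm_mul_mod_reducedForm (by omega), h, Nat.mod_eq_of_lt (by omega)]
    exact min_eq_left (by omega)
  have e1 : reducedForm v (u * 1 % v) = u := by
    rw [mul_one, Nat.mod_eq_of_lt (by omega)]
    exact min_eq_left (by omega)
  have eh := e hh.2.1 hwv hh.2.2
  have ek := e hk.2.1 (by omega) hk.2.2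
  have one_lt : ∀ {g}, 1 ≤ g → g ≤ v - 1 → reducedForm v g ≠ 1 → 1 < reducedForm v g := by
    intro g h1 h2 h3
    unfold reducedForm at h3 ⊢
    omega
  have le_half : ∀ g, reducedForm v g ≤ v / 2 := by
    intro g
    unfold reducedForm
    omega
  have := (isRealizable_of_fBHR_min_max_le
    (one_lt hh.1 hh.2.1 fun h1 => huw (by rw [← eh, h1, e1]))
    (one_lt hk.1 hk.2.1 fun h1 => by rw [h1, e1] at ek; omega)
    (fun h1 => by rw [h1, ek] at eh; omega) (le_half h) (le_half k) hb hc habc ha).map_mul hg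
  rwa [map_mset3, e1, eh, ek] at this

end Cyclic

/-- Counterexample characterization refined. Here `h₁, h₂, h₃, h₄`
are the (unique) solutions in `{1, …, v-1}` of `x·h₁ ≡ y`, `x·h₂ ≡ 1`,
`y·h₃ ≡ 1` and `y·h₄ ≡ x (mod v)`, and `ẋ, ẏ, ẍ, ÿ` are the min/max of the
corresponding reduced forms. -/
theorem stmt9 (v x y a b c h₁ h₂ h₃ h₄ : ℕ)
    (hv : 2 ≤ v) (hx : 1 < x) (hxy : x < y) (hy : y ≤ v / 2)
    (hgx : Nat.gcd v x = 1) (hgy : Nat.gcd v y = 1)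
    (ha : 1 ≤ a) (hb : 1 ≤ b) (hc : 1 ≤ c) (habc : a + b + c = v - 1)
    (hh₁ : 1 ≤ h₁ ∧ h₁ ≤ v - 1 ∧ (x * h₁) % v = y % v)
    (hh₂ : 1 ≤ h₂ ∧ h₂ ≤ v - 1 ∧ (x * h₂) % v = 1 % v)
    (hh₃ : 1 ≤ h₃ ∧ h₃ ≤ v - 1 ∧ (y * h₃) % v = 1 % v)
    (hh₄ : 1 ≤ h₄ ∧ h₄ ≤ v - 1 ∧ (y * h₄) % v = x % v) :
    ((fBHR x y ≤ a ∨
      fBHR (min (reducedForm v h₁) (reducedForm v h₂))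
           (max (reducedForm v h₁) (reducedForm v h₂)) ≤ b ∨
      fBHR (min (reducedForm v h₃) (reducedForm v h₄))
           (max (reducedForm v h₃) (reducedForm v h₄)) ≤ c) →
      IsRealizable v (mset3 a b c x y)) ∧
    (¬ IsRealizable v (mset3 a b c x y) →
      v + 2 ≤ fBHR x y +
        fBHR (min (reducedForm v h₁) (reducedForm v h₂))
             (max (reducedForm v h₁) (reducedForm v h₂)) +
        fBHR (min (reducedForm v h₃) (reducedForm v h₄))
             (max (reducedForm v h₃) (reducedForm v h₄))) := by
  have key : (fBHR x y ≤ a ∨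
      fBHR (min (reducedForm v h₁) (reducedForm v h₂))
           (max (reducedForm v h₁) (reducedForm v h₂)) ≤ b ∨
      fBHR (min (reducedForm v h₃) (reducedForm v h₄))
           (max (reducedForm v h₃) (reducedForm v h₄)) ≤ c) →
      IsRealizable v (mset3 a b c x y) := by
    rintro (h | h | h)
    · exact isRealizable_of_fBHR_le hx hxy hy hb (by omega) h
    · have := isRealizable_of_mul_mod hx (by omega) hxy.ne (by omega) hy hgx hh₁ hh₂ hc ha
        (by omega) h
      convert this using 1
      simp only [mset3]
      abel
    · rw [min_comm, max_comm] at h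
      have := isRealizable_of_mul_mod (by omega) hx hxy.ne' hy (by omega) hgy hh₄ hh₃ hb ha
        (by omega) h
      convert this using 1
      simp only [mset3]
      abel
  refine ⟨key, fun hn => ?_⟩
  have h := mt key hn
  omega
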